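/- There do not exist positive integers k₁, k₂, k₃, k₄, each a perfect square and not all equal, such that d₀ := 1 + k₁ + k₂ + k₃ + k₄ is a perfect square and each kᵢ divides d₀. -/

import Mathlib

/-- A proper divisor `a` of `n` is `n / 2` or at most `n / 3`; stated for the squares. -/
theorem sq_dichotomy (a n : ℕ) (ha : 0 < a) (hlt : a * a < n * n) (hd : a * a ∣ n * n) :
    4 * (a * a) = n * n ∨ (9 * (a * a) ≤ n * n ∧ 9 ≤ n * n) := by
  have hd' : a ∣ n := by
    rw [← pow_two, ← pow_two] at hd
    exact (Nat.pow_dvd_pow_iff two_ne_zero).1 hd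
  obtain ⟨x, rfl⟩ := hd'
  have hx : 2 ≤ x := by
    by_contra h
    have : x = 0 ∨ x = 1 := by omega
    rcases this with rfl | rfl <;> simp at hlt
  rcases Nat.eq_or_lt_of_le hx with rfl | hx
  · left; ring
  · right
    have h9 : 3 * 3 ≤ x * x := Nat.mul_le_mul hx hx
    have ha1 : 1 ≤ a * a := Nat.mul_pos ha ha
    constructor <;> nlinarith

/-- there are no positive perfect squares `k₁, k₂, k₃, k₄`, not all
equal, such that `d₀ = 1 + k₁ + k₂ + k₃ + k₄` is a perfect square and each `kᵢ`
divides `d₀`. -/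
theorem stmt19 :
    ¬ ∃ k₁ k₂ k₃ k₄ : ℕ,
      0 < k₁ ∧ 0 < k₂ ∧ 0 < k₃ ∧ 0 < k₄ ∧
      IsSquare k₁ ∧ IsSquare k₂ ∧ IsSquare k₃ ∧ IsSquare k₄ ∧
      ¬ (k₁ = k₂ ∧ k₂ = k₃ ∧ k₃ = k₄) ∧
      IsSquare (1 + k₁ + k₂ + k₃ + k₄) ∧
      k₁ ∣ (1 + k₁ + k₂ + k₃ + k₄) ∧ k₂ ∣ (1 + k₁ + k₂ + k₃ + k₄) ∧
      k₃ ∣ (1 + k₁ + k₂ + k₃ + k₄) ∧ k₄ ∣ (1 + k₁ + k₂ + k₃ + k₄) := by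
  rintro ⟨_, _, _, _, h1, h2, h3, h4, ⟨a, rfl⟩, ⟨b, rfl⟩, ⟨c, rfl⟩, ⟨d, rfl⟩, -, ⟨n, hn⟩,
    d1, d2, d3, d4⟩
  rw [hn] at d1 d2 d3 d4
  have e1 := sq_dichotomy a n (Nat.pos_of_ne_zero (by rintro rfl; simp at h1)) (by omega) d1
  have e2 := sq_dichotomy b n (Nat.pos_of_ne_zero (by rintro rfl; simp at h2)) (by omega) d2
  have e3 := sq_dichotomy c n (Nat.pos_of_ne_zero (by rintro rfl; simp at h3)) (by omega) d3
  have e4 := sq_dichotomy d n (Nat.pos_of_ne_zero (by rintro rfl; simp at h4)) (by omega) d4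
  omega
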